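/- arXiv:2603.05943 — 3 statements merged into one kernel-verified Lean document; each statement's English description precedes it below -/
import Mathlib

section
/- The inner derivation I_x maps the centralizer V of B in A into Ker(τ) ∩ A_1; that is, for every v ∈ A commuting with all elements of B, the element vx − xv lies in A_1 and τ(vx − xv) = 0. -/
open Finset

/-- The additive subgroup of elements `∑_{i < n} X ^ i * ι (b i)`: the skew polynomials of
degree less than `n`. -/
def skewDegreeLT {B R : Type*} [Ring B] [Ring R] (ι : B →+* R) (X : R) (n : ℕ) :
    AddSubgroup R :=
  AddSubgroup.closure {r | ∃ i < n, ∃ b, r = X ^ i * ι b}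

section SkewPolynomial

variable {B R : Type*} [Ring B] [Ring R] {ι : B →+* R} {X : R}

lemma pow_mul_mem_skewDegreeLT {i n : ℕ} (h : i < n) (b : B) :
    X ^ i * ι b ∈ skewDegreeLT ι X n :=
  AddSubgroup.subset_closure ⟨i, h, b, rfl⟩

lemma sum_mem_skewDegreeLT (n : ℕ) (c : ℕ → B) :
    ∑ i ∈ range n, X ^ i * ι (c i) ∈ skewDegreeLT ι X n :=
  AddSubgroup.sum_mem _ fun _ hi => pow_mul_mem_skewDegreeLT (mem_range.1 hi) _

lemma exists_sum_of_mem_skewDegreeLT {n : ℕ} {r : R} (h : r ∈ skewDegreeLT ι X n) :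
    ∃ c : ℕ → B, r = ∑ i ∈ range n, X ^ i * ι (c i) := by
  induction h using AddSubgroup.closure_induction with
  | mem r hr =>
    obtain ⟨i, hi, b, rfl⟩ := hr
    refine ⟨Pi.single i b, ?_⟩
    rw [sum_eq_single_of_mem i (mem_range.2 hi)]
    · simp
    · intro j _ hj
      simp [Pi.single_eq_of_ne hj]
  | zero => exact ⟨0, by simp⟩
  | add r s _ _ hr hs =>
    obtain ⟨c, rfl⟩ := hr
    obtain ⟨d, rfl⟩ := hs
    exact ⟨c + d, by simp [mul_add, sum_add_distrib]⟩
  | neg r _ hr =>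
    obtain ⟨c, rfl⟩ := hr
    exact ⟨-c, by simp⟩

lemma mul_coeff_mem_skewDegreeLT {n : ℕ} {r : R} (h : r ∈ skewDegreeLT ι X n) (b : B) :
    r * ι b ∈ skewDegreeLT ι X n := by
  obtain ⟨c, rfl⟩ := exists_sum_of_mem_skewDegreeLT h
  simp_rw [sum_mul, mul_assoc, ← map_mul]
  exact sum_mem_skewDegreeLT n fun i => c i * b

lemma mul_X_mem_skewDegreeLT {ρ : B ≃+* B} {D : B →+ B}
    (hcomm : ∀ α : B, ι α * X = X * ι (ρ α) + ι (D α)) {n : ℕ} {r : R}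
    (h : r ∈ skewDegreeLT ι X n) : r * X ∈ skewDegreeLT ι X (n + 1) := by
  obtain ⟨c, rfl⟩ := exists_sum_of_mem_skewDegreeLT h
  rw [sum_mul]
  refine AddSubgroup.sum_mem _ fun i hi => ?_
  have hi := mem_range.1 hi
  rw [mul_assoc, hcomm, mul_add, ← mul_assoc, ← pow_succ]
  exact add_mem (pow_mul_mem_skewDegreeLT (by omega) _)
    (pow_mul_mem_skewDegreeLT (by omega) _)

lemma mul_X_pow_mem_skewDegreeLT {ρ : B ≃+* B} {D : B →+ B}
    (hcomm : ∀ α : B, ι α * X = X * ι (ρ α) + ι (D α)) {n : ℕ} {r : R}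
    (h : r ∈ skewDegreeLT ι X n) (k : ℕ) : r * X ^ k ∈ skewDegreeLT ι X (n + k) := by
  induction k with
  | zero => simpa using h
  | succ k ih =>
    rw [pow_succ, ← mul_assoc]
    exact mul_X_mem_skewDegreeLT hcomm ih

lemma skewDegreeLT_mono {k n : ℕ} (h : k ≤ n) : skewDegreeLT ι X k ≤ skewDegreeLT ι X n :=
  AddSubgroup.closure_mono fun _ ⟨i, hi, b, hr⟩ => ⟨i, hi.trans_le h, b, hr⟩

lemma coeff_eq_zero_of_sum_eq_zero
    (hfree : ∀ r : R, ∃! c : ℕ →₀ B, r = c.sum fun i b => X ^ i * ι b) {n : ℕ} {c : ℕ → B}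
    (h : ∑ i ∈ range n, X ^ i * ι (c i) = 0) {i : ℕ} (hi : i < n) : c i = 0 := by
  have hc : (∑ j ∈ range n, Finsupp.single j (c j)) = 0 := by
    refine (hfree 0).unique ?_ (by simp)
    rw [← Finsupp.sum_finsetSum_index (by simp) (by simp [mul_add]), ← h]
    exact sum_congr rfl fun j _ => by simp
  have := DFunLike.congr_fun hc i
  simpa [Finsupp.finsetSum_apply, Finsupp.single_apply, hi] using this

lemma eq_zero_of_X_pow_mul_mem_skewDegreeLT
    (hfree : ∀ r : R, ∃! c : ℕ →₀ B, r = c.sum fun i b => X ^ i * ι b) {n : ℕ} {b : B}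
    (h : X ^ n * ι b ∈ skewDegreeLT ι X n) : b = 0 := by
  obtain ⟨c, hc⟩ := exists_sum_of_mem_skewDegreeLT h
  have key : ∑ i ∈ range (n + 1), X ^ i * ι ((fun i => if i = n then -b else c i) i) = 0 := by
    rw [sum_range_succ, sum_congr rfl (g := fun i => X ^ i * ι (c i)), ← hc]
    · simp
    · intro i hi
      simp [(mem_range.1 hi).ne]
  simpa using coeff_eq_zero_of_sum_eq_zero hfree key n.lt_succ_self

/-- A right multiple of a monic skew polynomial of degree `m` that has degree less than `m`
is the multiple by zero. -/
lemma eq_zero_of_monic_mul_mem_skewDegreeLT {ρ : B ≃+* B} {D : B →+ B}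
    (hcomm : ∀ α : B, ι α * X = X * ι (ρ α) + ι (D α))
    (hfree : ∀ r : R, ∃! c : ℕ →₀ B, r = c.sum fun i b => X ^ i * ι b) {m : ℕ} {g : R}
    (hg : g ∈ skewDegreeLT ι X m) {n : ℕ} {s : R} (hs : s ∈ skewDegreeLT ι X n)
    (h : (X ^ m + g) * s ∈ skewDegreeLT ι X m) : s = 0 := by
  have hf : X ^ m + g ∈ skewDegreeLT ι X (m + 1) :=
    add_mem (by simpa using pow_mul_mem_skewDegreeLT (ι := ι) (X := X) m.lt_succ_self 1)
      (skewDegreeLT_mono m.le_succ hg)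
  obtain ⟨b, rfl⟩ := exists_sum_of_mem_skewDegreeLT hs
  clear hs
  induction n with
  | zero => simp
  | succ n ih =>
    have low : (X ^ m + g) * ∑ i ∈ range n, X ^ i * ι (b i) ∈ skewDegreeLT ι X (m + n) := by
      rw [mul_sum]
      refine AddSubgroup.sum_mem _ fun i hi => ?_
      have hi := mem_range.1 hi
      rw [← mul_assoc]
      exact mul_coeff_mem_skewDegreeLT
        (skewDegreeLT_mono (by omega) (mul_X_pow_mem_skewDegreeLT hcomm hf i)) _
    have hgn : g * X ^ n * ι (b n) ∈ skewDegreeLT ι X (m + n) :=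
      mul_coeff_mem_skewDegreeLT (mul_X_pow_mem_skewDegreeLT hcomm hg n) _
    have hb : b n = 0 := by
      apply eq_zero_of_X_pow_mul_mem_skewDegreeLT hfree (n := m + n)
      have := sub_mem (sub_mem (skewDegreeLT_mono (Nat.le_add_right m n) h) low) hgn
      convert this using 1
      rw [sum_range_succ, pow_add]
      noncomm_ring
    rw [sum_range_succ, hb, map_zero, mul_zero, add_zero] at h ⊢
    exact ih h

/-- The coefficients of a monic two-sided skew polynomial with `ρ`-fixed coefficients are
killed by `D`. -/
lemma derivation_coeff_eq_zero {ρ : B ≃+* B} {D : B →+ B}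
    (hD : ∀ α β : B, D (α * β) = D α * ρ β + α * D β)
    (hcomm : ∀ α : B, ι α * X = X * ι (ρ α) + ι (D α))
    (hfree : ∀ r : R, ∃! c : ℕ →₀ B, r = c.sum fun i b => X ^ i * ι b)
    {m : ℕ} {a : ℕ → B} (ham : a m = 1) (hρa : ∀ i ≤ m, ρ (a i) = a i)
    {f : R} (hf : f = ∑ i ∈ range (m + 1), X ^ i * ι (a i))
    (htwo : (Set.range fun r => f * r) = Set.range fun r => r * f) {i : ℕ} (hi : i ≤ m) :
    D (a i) = 0 := by
  have hD1 : D 1 = 0 := by simpa using hD 1 1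
  have hfX : f * X - X * f = ∑ i ∈ range m, X ^ i * ι (D (a i)) := by
    have : f * X - X * f = ∑ i ∈ range (m + 1), X ^ i * ι (D (a i)) := by
      rw [hf, sum_mul, mul_sum, ← sum_sub_distrib]
      refine sum_congr rfl fun i hi => ?_
      rw [mul_assoc, hcomm, hρa i (Nat.lt_succ_iff.1 (mem_range.1 hi)), mul_add, ← mul_assoc,
        ← mul_assoc, ← pow_succ, ← pow_succ', add_sub_cancel_left]
    rw [this, sum_range_succ, ham, hD1, map_zero, mul_zero, add_zero]
  obtain ⟨t, ht⟩ : X * f ∈ Set.range fun r => f * r := htwo ▸ ⟨X, rfl⟩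
  have hfs : f * (X - t) = f * X - X * f := by rw [mul_sub]; exact congrArg _ ht
  have hs : X - t = 0 := by
    obtain ⟨c, hc, -⟩ := hfree (X - t)
    refine eq_zero_of_monic_mul_mem_skewDegreeLT hcomm hfree
      (sum_mem_skewDegreeLT m a) (n := c.support.sup id + 1) ?_ ?_
    · rw [hc]
      exact AddSubgroup.sum_mem _ fun i hi =>
        pow_mul_mem_skewDegreeLT (Nat.lt_succ_of_le (le_sup (f := id) hi)) _
    · have hf' : X ^ m + ∑ i ∈ range m, X ^ i * ι (a i) = f := by
        rw [hf, sum_range_succ, ham, map_one, mul_one, add_comm]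
      rw [hf', hfs, hfX]
      exact sum_mem_skewDegreeLT m _
  rcases hi.lt_or_eq with hi | rfl
  · refine coeff_eq_zero_of_sum_eq_zero hfree (c := fun i => D (a i)) ?_ hi
    rw [← hfX, ← hfs, hs, mul_zero]
  · rw [ham, hD1]

end SkewPolynomial

/-- Telescoping: if `x * y 0 = -a 0` and `x * y (j + 1) = y j - a (j + 1)`, the sum
`∑_{j < n} y j * (v * x - x * v) * x ^ j` collapses. -/
lemma sum_mul_commutator_mul_pow {A : Type*} [Ring A] {x v : A} {y a : ℕ → A} {n : ℕ}
    (hyx : ∀ j ≤ n, y j * x = x * y j) (h0 : x * y 0 = -a 0)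
    (hsucc : ∀ j < n, x * y (j + 1) = y j - a (j + 1)) :
    ∑ j ∈ range (n + 1), y j * (v * x - x * v) * x ^ j =
      y n * v * x ^ (n + 1) + ∑ j ∈ range (n + 1), a j * v * x ^ j := by
  induction n with
  | zero =>
    have : y 0 * x = -a 0 := by rw [hyx 0 le_rfl, h0]
    simp [mul_sub, ← mul_assoc, this]
  | succ n ih =>
    have hx : y (n + 1) * x = y n - a (n + 1) := by rw [hyx _ le_rfl, hsucc n n.lt_succ_self]
    rw [sum_range_succ, ih (fun j hj => hyx j (by omega)) (fun j hj => hsucc j (by omega)),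
      sum_range_succ _ (n + 1), mul_sub, ← mul_assoc _ x v, hx, pow_succ' x (n + 1)]
    noncomm_ring

/-- In the setting of a monic `f = Σ_{i=0}^{m} X^i a_i` of degree `m ≥ 1` in `R = B[X;ρ,D]`
with all `a_i ∈ B^ρ` and `fR = Rf`, with `A = R/fR`, `x = X + fR`,
`y_j = Σ_{k=j}^{m−1} x^{k−j} a_{k+1}` and `τ(z) = Σ_{j=0}^{m−1} y_j z x^j`:
the inner derivation `I_x` maps the centralizer `V` of `B` in `A` into `Ker(τ) ∩ A_1`;
that is, for every `v ∈ A` commuting with all elements of `B`, the element `vx − xv`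
lies in `A_1` and `τ(vx − xv) = 0`. -/
theorem stmt6 {B R A : Type*} [Ring B] [Ring R] [Ring A]
    (ι : B →+* R) (hι : Function.Injective ι) (X : R)
    (ρ : B ≃+* B) (D : B →+ B)
    (hD : ∀ α β : B, D (α * β) = D α * ρ β + α * D β)
    (hcomm : ∀ α : B, ι α * X = X * ι (ρ α) + ι (D α))
    (hfree : ∀ r : R, ∃! c : ℕ →₀ B, r = c.sum fun i b => X ^ i * ι b)
    (m : ℕ) (hm : 1 ≤ m) (a : ℕ → B) (ham : a m = 1)
    (hρa : ∀ i ≤ m, ρ (a i) = a i)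
    (f : R) (hf : f = ∑ i ∈ Finset.range (m + 1), X ^ i * ι (a i))
    (htwo : (Set.range fun r => f * r) = Set.range fun r => r * f)
    (π : R →+* A) (hπ : Function.Surjective π)
    (hker : ∀ r : R, π r = 0 ↔ ∃ s, r = f * s)
    (y : ℕ → A)
    (hy : ∀ j, y j = ∑ k ∈ Finset.Icc j (m - 1), π X ^ (k - j) * π (ι (a (k + 1))))
    (τ : A → A)
    (hτ : ∀ z, τ z = ∑ j ∈ Finset.range m, y j * z * π X ^ j)
    (v : A) (hv : ∀ α : B, π (ι α) * v = v * π (ι α)) :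
    (∀ α : B, π (ι α) * (v * π X - π X * v) = (v * π X - π X * v) * π (ι (ρ α))) ∧
      τ (v * π X - π X * v) = 0 := by
  have hx (α : B) : π (ι α) * π X = π X * π (ι (ρ α)) + π (ι (D α)) := by
    rw [← map_mul, hcomm, map_add, map_mul]
  have hax (i : ℕ) (hi : i ≤ m) : Commute (π (ι (a i))) (π X) := by
    have := hx (a i)
    rwa [hρa i hi, derivation_coeff_eq_zero hD hcomm hfree ham hρa hf htwo hi, map_zero,
      map_zero, add_zero] at this
  have hf0 : ∑ i ∈ range (m + 1), π X ^ i * π (ι (a i)) = 0 := by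
    simpa [hf] using (hker f).2 ⟨1, (mul_one f).symm⟩
  refine ⟨fun α => ?_, ?_⟩
  · have hvx : π (ι α) * (v * π X) = v * (π X * π (ι (ρ α)) + π (ι (D α))) := by
      rw [← mul_assoc, hv, mul_assoc, hx]
    have hxv : π (ι α) * (π X * v) = π X * v * π (ι (ρ α)) + v * π (ι (D α)) := by
      rw [← mul_assoc, hx, add_mul, mul_assoc, hv, hv, mul_assoc]
    rw [mul_sub, hvx, hxv]
    noncomm_ring
  · obtain ⟨n, rfl⟩ := Nat.exists_eq_add_of_le' hm
    have hyx (j : ℕ) : Commute (y j) (π X) := by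
      rw [hy]
      refine Commute.sum_left _ _ _ fun k hk => ?_
      have hk := (mem_Icc.1 hk).2
      exact ((Commute.refl _).pow_left _).mul_left (hax _ (by omega))
    have hyn : y n = 1 := by simp [hy, ham]
    have hxy (j : ℕ) :
        π X * y j = ∑ k ∈ Icc j n, π X ^ (k + 1 - j) * π (ι (a (k + 1))) := by
      rw [hy, mul_sum]
      refine sum_congr rfl fun k hk => ?_
      rw [← mul_assoc, ← pow_succ', Nat.sub_add_comm (mem_Icc.1 hk).1]
    rw [hτ, sum_mul_commutator_mul_pow (a := fun j => π (ι (a j))) (fun j _ => hyx j), hyn]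
    · have hterm (j : ℕ) (hj : j ≤ n + 1) :
          π (ι (a j)) * v * π X ^ j = v * (π X ^ j * π (ι (a j))) := by
        rw [hv, mul_assoc, ((hax j hj).pow_right j).eq]
      rw [sum_congr rfl fun j hj => hterm j (mem_range.1 hj).le, ← mul_sum, one_mul]
      rw [sum_range_succ, ham, map_one, map_one, mul_one] at hf0
      rw [← mul_add, add_comm, hf0, mul_zero]
    · rw [hxy, eq_neg_iff_add_eq_zero, ← hf0, sum_range_succ' _ (n + 1),
        Nat.range_succ_eq_Icc_zero]
      simp
    · intro j hj
      rw [hxy, hy (j := j), eq_sub_iff_add_eq, add_tsub_cancel_right,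
        ← insert_Icc_add_one_left_eq_Icc hj.le, sum_insert (by simp)]
      simp [add_comm]
end

section
/- Let g_1 ∈ R_1 = {g ∈ R : αg = gρ(α) for all α ∈ B}, and define g_0 = 0 and g_{j+1} = g_j X + X^j g_1 for j ≥ 0. Then for every α ∈ B and every j ≥ 1, α·g_j = Σ_{k=1}^{j} g_k·Φ_{[j,k]}(α). -/
/-- The additive endomorphisms `Φ_{[i,j]}` of `B` determined by an automorphism `ρ`
and a `ρ`-derivation `D`:  `Φ_{[0,0]} = id`, `Φ_{[i,0]} = D^i`, `Φ_{[i,i]} = ρ^i`, and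
`Φ_{[i,j]} = ρ ∘ Φ_{[i−1,j−1]} + D ∘ Φ_{[i−1,j]}` (with `Φ_{[i,j]} = 0` for `j > i`). -/
def Phi {B : Type*} [Ring B] (ρ D : B → B) : ℕ → ℕ → B → B
  | 0, 0 => id
  | 0, _ + 1 => fun _ => 0
  | i + 1, 0 => D ∘ Phi ρ D i 0
  | i + 1, j + 1 => fun α => ρ (Phi ρ D i j α) + D (Phi ρ D i (j + 1) α)

/-- `Φ_{[i,j]}` vanishes for `j > i`. -/
theorem Phi_eq_zero_of_lt {B : Type*} [Ring B] (ρ : B ≃+* B) (D : B →+ B) (α : B) :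
    ∀ {i j : ℕ}, i < j → Phi ρ D i j α = 0
  | 0, _ + 1, _ => rfl
  | i + 1, j + 1, h => by
    simp [Phi, Phi_eq_zero_of_lt ρ D α (show i < j by omega),
      Phi_eq_zero_of_lt ρ D α (show i < j + 1 by omega)]

/-- The recursion of `Φ`, summed against an arbitrary sequence of coefficients. -/
theorem sum_mul_Phi_succ {B R : Type*} [Ring B] [Ring R] (ι : B →+* R)
    (ρ : B ≃+* B) (D : B →+ B) (u : ℕ → R) (α : B) (n : ℕ) :
    ∑ k ∈ Finset.range (n + 2), u k * ι (Phi ρ D (n + 1) k α) =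
      ∑ k ∈ Finset.range (n + 1),
        (u (k + 1) * ι (ρ (Phi ρ D n k α)) + u k * ι (D (Phi ρ D n k α))) := by
  have shift : ∑ k ∈ Finset.range (n + 1), u k * ι (D (Phi ρ D n k α)) =
      ∑ k ∈ Finset.range (n + 1), u (k + 1) * ι (D (Phi ρ D n (k + 1) α)) +
        u 0 * ι (D (Phi ρ D n 0 α)) := by
    rw [← Finset.sum_range_succ' (fun k => u k * ι (D (Phi ρ D n k α))),
      Finset.sum_range_succ _ (n + 1), Phi_eq_zero_of_lt ρ D α n.lt_succ_self]
    simp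
  rw [Finset.sum_add_distrib, shift, Finset.sum_range_succ', ← add_assoc,
    ← Finset.sum_add_distrib]
  simp [Phi, mul_add]

/-- Commuting a scalar past a power of `X`. -/
theorem scalar_mul_X_pow {B R : Type*} [Ring B] [Ring R] (ι : B →+* R) (X : R)
    (ρ : B ≃+* B) (D : B →+ B)
    (hcomm : ∀ α : B, ι α * X = X * ι (ρ α) + ι (D α)) (α : B) (n : ℕ) :
    ι α * X ^ n = ∑ k ∈ Finset.range (n + 1), X ^ k * ι (Phi ρ D n k α) := by
  induction n with
  | zero => simp [Phi]
  | succ n ih =>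
    rw [sum_mul_Phi_succ, pow_succ, ← mul_assoc, ih, Finset.sum_mul]
    refine Finset.sum_congr rfl fun k _ => ?_
    rw [mul_assoc, hcomm, mul_add, pow_succ, mul_assoc]

/-- Commuting a scalar past `g n`, with the vanishing term `g 0` included in the sum. -/
theorem scalar_mul_eq_sum_range {B R : Type*} [Ring B] [Ring R] (ι : B →+* R) (X : R)
    (ρ : B ≃+* B) (D : B →+ B)
    (hcomm : ∀ α : B, ι α * X = X * ι (ρ α) + ι (D α))
    (g : ℕ → R) (hg0 : g 0 = 0)
    (hgrec : ∀ j, g (j + 1) = g j * X + X ^ j * g 1)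
    (hg1 : ∀ α : B, ι α * g 1 = g 1 * ι (ρ α)) (α : B) (n : ℕ) :
    ι α * g n = ∑ k ∈ Finset.range (n + 1), g k * ι (Phi ρ D n k α) := by
  induction n with
  | zero => simp [hg0]
  | succ n ih =>
    rw [sum_mul_Phi_succ, hgrec, mul_add, ← mul_assoc, ← mul_assoc, ih,
      scalar_mul_X_pow ι X ρ D hcomm, Finset.sum_mul, Finset.sum_mul,
      ← Finset.sum_add_distrib]
    refine Finset.sum_congr rfl fun k _ => ?_
    rw [mul_assoc, hcomm, mul_assoc, hg1, hgrec k]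
    noncomm_ring

/-- In the skew polynomial ring `R = B[X;ρ,D]`, let
`g_1 ∈ R_1 = {g ∈ R : αg = gρ(α) for all α ∈ B}` and define `g_0 = 0` and
`g_{j+1} = g_j X + X^j g_1` for `j ≥ 0`.  Then for every `α ∈ B` and every `j ≥ 1`,
`α·g_j = Σ_{k=1}^{j} g_k·Φ_{[j,k]}(α)`. -/
theorem stmt8 {B R : Type*} [Ring B] [Ring R]
    (ι : B →+* R) (hι : Function.Injective ι) (X : R)
    (ρ : B ≃+* B) (D : B →+ B)
    (hD : ∀ α β : B, D (α * β) = D α * ρ β + α * D β)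
    (hcomm : ∀ α : B, ι α * X = X * ι (ρ α) + ι (D α))
    (hfree : ∀ r : R, ∃! c : ℕ →₀ B, r = c.sum fun i b => X ^ i * ι b)
    (g : ℕ → R) (hg0 : g 0 = 0)
    (hgrec : ∀ j, g (j + 1) = g j * X + X ^ j * g 1)
    (hg1 : ∀ α : B, ι α * g 1 = g 1 * ι (ρ α)) :
    ∀ α : B, ∀ j, 1 ≤ j →
      ι α * g j = ∑ k ∈ Finset.Icc 1 j, g k * ι (Phi (⇑ρ) (⇑D) j k α) := by
  intro α j _
  rw [scalar_mul_eq_sum_range ι X ρ D hcomm g hg0 hgrec hg1, Finset.sum_range_succ', hg0,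
    zero_mul, add_zero, Finset.range_eq_Ico,
    Finset.sum_Ico_add' (fun k => g k * ι (Phi ρ D j k α)) 0 j 1]
  rfl
end

section
/- If δ is a B-derivation of A = R/fR, then δ(x) ∈ A_1 and τ(δ(x)) = 0; that is, δ(x) ∈ A_1 ∩ Ker(τ). -/
namespace SkewPolynomial

variable {B R : Type*} [Ring B] [Ring R]

/-- The elements of `R` of the form `Σ_{i<n} X^i b_i`. -/
def degreeLT (ι : B →+* R) (X : R) (n : ℕ) : AddSubgroup R where
  carrier := {r | ∃ b : ℕ → B, r = ∑ i ∈ Finset.range n, X ^ i * ι (b i)}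
  zero_mem' := ⟨0, by simp⟩
  add_mem' := by
    rintro _ _ ⟨b, rfl⟩ ⟨c, rfl⟩
    exact ⟨b + c, by simp [mul_add, Finset.sum_add_distrib]⟩
  neg_mem' := by
    rintro _ ⟨b, rfl⟩
    exact ⟨-b, by simp⟩

variable {ι : B →+* R} {X : R}

theorem monomial_mem_degreeLT {i n : ℕ} (h : i < n) (b : B) :
    X ^ i * ι b ∈ degreeLT ι X n :=
  ⟨Pi.single i b, by
    rw [Finset.sum_eq_single_of_mem i (Finset.mem_range.2 h)]
    · simp
    · intro j _ hj
      simp [Pi.single_eq_of_ne hj]⟩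

theorem degreeLT_mono {m n : ℕ} (h : m ≤ n) : degreeLT ι X m ≤ degreeLT ι X n := by
  rintro _ ⟨b, rfl⟩
  exact sum_mem fun i hi =>
    monomial_mem_degreeLT ((Finset.mem_range.1 hi).trans_le h) _

theorem mul_coeff_mem_degreeLT {n : ℕ} {r : R} (hr : r ∈ degreeLT ι X n) (c : B) :
    r * ι c ∈ degreeLT ι X n := by
  obtain ⟨b, rfl⟩ := hr
  exact ⟨fun i => b i * c, by simp [Finset.sum_mul, mul_assoc]⟩

theorem mul_X_mem_degreeLT {ρ : B ≃+* B} {D : B →+ B}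
    (hcomm : ∀ α : B, ι α * X = X * ι (ρ α) + ι (D α))
    {n : ℕ} {r : R} (hr : r ∈ degreeLT ι X n) : r * X ∈ degreeLT ι X (n + 1) := by
  obtain ⟨b, rfl⟩ := hr
  rw [Finset.sum_mul]
  refine sum_mem fun i hi => ?_
  have hi := Finset.mem_range.1 hi
  rw [mul_assoc, hcomm, mul_add, ← mul_assoc, ← pow_succ]
  exact add_mem (monomial_mem_degreeLT (by omega) _) (monomial_mem_degreeLT (by omega) _)

theorem mul_X_pow_mem_degreeLT {ρ : B ≃+* B} {D : B →+ B}
    (hcomm : ∀ α : B, ι α * X = X * ι (ρ α) + ι (D α))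
    {n : ℕ} {r : R} (hr : r ∈ degreeLT ι X n) (k : ℕ) :
    r * X ^ k ∈ degreeLT ι X (n + k) := by
  induction k with
  | zero => simpa using hr
  | succ k ih =>
    rw [pow_succ, ← mul_assoc, ← add_assoc]
    exact mul_X_mem_degreeLT hcomm ih

theorem coeff_eq_zero_of_sum_eq_zero
    (hfree : ∀ r : R, ∃! c : ℕ →₀ B, r = c.sum fun i b => X ^ i * ι b)
    {n : ℕ} {b : ℕ → B} (h : ∑ i ∈ Finset.range n, X ^ i * ι (b i) = 0)
    {i : ℕ} (hi : i < n) : b i = 0 := by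
  classical
  let c : ℕ →₀ B := Finsupp.onFinset (Finset.range n)
    (fun i => if i < n then b i else 0) (by intro j hj; by_contra hn; simp_all)
  have hc : (0 : R) = c.sum fun i b => X ^ i * ι b := by
    rw [Finsupp.onFinset_sum _ (by simp), ← h]
    exact Finset.sum_congr rfl fun j hj => by rw [if_pos (Finset.mem_range.1 hj)]
  have hc0 : c = 0 := (hfree 0).unique hc (by simp)
  simpa [c, hi] using DFunLike.congr_fun hc0 i

theorem coeff_eq_zero_of_monomial_mem_degreeLT
    (hfree : ∀ r : R, ∃! c : ℕ →₀ B, r = c.sum fun i b => X ^ i * ι b)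
    {n : ℕ} {c : B} (h : X ^ n * ι c ∈ degreeLT ι X n) : c = 0 := by
  obtain ⟨b, hb⟩ := h
  have key : ∑ i ∈ Finset.range (n + 1), X ^ i * ι (if i = n then -c else b i) = 0 := by
    rw [Finset.sum_range_succ, Finset.sum_congr rfl (g := fun i => X ^ i * ι (b i)), ← hb]
    · simp
    · intro i hi
      rw [if_neg (Finset.mem_range.1 hi).ne]
  simpa using coeff_eq_zero_of_sum_eq_zero hfree key (Nat.lt_succ_self n)

/-- A right multiple of a monic polynomial of degree `m` that has degree `< m` is zero. -/
theorem eq_zero_of_monic_mul_mem_degreeLT {ρ : B ≃+* B} {D : B →+ B}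
    (hcomm : ∀ α : B, ι α * X = X * ι (ρ α) + ι (D α))
    (hfree : ∀ r : R, ∃! c : ℕ →₀ B, r = c.sum fun i b => X ^ i * ι b)
    {m : ℕ} {f : R} (hf : f - X ^ m ∈ degreeLT ι X m) {s : R}
    (h : f * s ∈ degreeLT ι X m) : s = 0 := by
  have lead (n : ℕ) (c : B) :
      f * (X ^ n * ι c) - X ^ (m + n) * ι c ∈ degreeLT ι X (m + n) := by
    have := mul_coeff_mem_degreeLT (mul_X_pow_mem_degreeLT hcomm hf n) c
    rwa [sub_mul, sub_mul, ← pow_add, mul_assoc f] at this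
  have main (n : ℕ) (b : ℕ → B)
      (hb : f * ∑ i ∈ Finset.range n, X ^ i * ι (b i) ∈ degreeLT ι X m) :
      ∑ i ∈ Finset.range n, X ^ i * ι (b i) = 0 := by
    induction n with
    | zero => simp
    | succ n ih =>
      have low : f * ∑ i ∈ Finset.range n, X ^ i * ι (b i) ∈ degreeLT ι X (m + n) := by
        rw [Finset.mul_sum]
        refine sum_mem fun i hi => ?_
        have hi := Finset.mem_range.1 hi
        rw [← sub_add_cancel (f * (X ^ i * ι (b i))) (X ^ (m + i) * ι (b i))]
        exact add_mem (degreeLT_mono (by omega) (lead i (b i)))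
          (monomial_mem_degreeLT (by omega) _)
      have hbn : b n = 0 := by
        refine coeff_eq_zero_of_monomial_mem_degreeLT hfree (n := m + n) ?_
        have := sub_mem (sub_mem (degreeLT_mono (Nat.le_add_right m n) hb) low) (lead n (b n))
        rw [Finset.sum_range_succ, mul_add] at this
        simpa using this
      rw [Finset.sum_range_succ, hbn, map_zero, mul_zero, add_zero] at hb ⊢
      exact ih hb
  obtain ⟨c, hc, -⟩ := hfree s
  obtain ⟨N, hN⟩ : ∃ N, c.support ⊆ Finset.range N :=
    c.support.exists_nat_subset_range
  have hs : s = ∑ i ∈ Finset.range N, X ^ i * ι (c i) := by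
    rw [hc, Finsupp.sum_of_support_subset c hN _ (by simp)]
  rw [hs] at h ⊢
  exact main N c h

/-- The coefficients of a monic polynomial `f` with `ρ`-invariant coefficients and `fR = Rf`
are killed by `D`. -/
theorem derivation_coeff_eq_zero {ρ : B ≃+* B} {D : B →+ B}
    (hD : ∀ α β : B, D (α * β) = D α * ρ β + α * D β)
    (hcomm : ∀ α : B, ι α * X = X * ι (ρ α) + ι (D α))
    (hfree : ∀ r : R, ∃! c : ℕ →₀ B, r = c.sum fun i b => X ^ i * ι b)
    {m : ℕ} {a : ℕ → B} (ham : a m = 1) (hρa : ∀ i ≤ m, ρ (a i) = a i)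
    {f : R} (hf : f = ∑ i ∈ Finset.range (m + 1), X ^ i * ι (a i))
    (htwo : (Set.range fun r => f * r) = Set.range fun r => r * f)
    {i : ℕ} (hi : i ≤ m) : D (a i) = 0 := by
  have hD1 : D 1 = 0 := by simpa using hD 1 1
  have hmonic : f - X ^ m ∈ degreeLT ι X m :=
    ⟨a, by rw [hf, Finset.sum_range_succ, ham]; simp⟩
  have hcommutator : f * X - X * f = ∑ i ∈ Finset.range m, X ^ i * ι (D (a i)) := by
    have : f * X = X * f + ∑ i ∈ Finset.range (m + 1), X ^ i * ι (D (a i)) := by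
      rw [hf, Finset.sum_mul, Finset.mul_sum, ← Finset.sum_add_distrib]
      refine Finset.sum_congr rfl fun j hj => ?_
      rw [mul_assoc, hcomm, hρa j (Nat.lt_succ_iff.1 (Finset.mem_range.1 hj)), mul_add,
        ← mul_assoc, ← mul_assoc, ← pow_succ, ← pow_succ']
    rw [this, Finset.sum_range_succ, ham, hD1]
    simp
  obtain ⟨t, ht⟩ : X * f ∈ Set.range fun r => f * r := htwo ▸ ⟨X, rfl⟩
  have hmul : f * (X - t) = ∑ i ∈ Finset.range m, X ^ i * ι (D (a i)) := by
    rw [mul_sub, ← hcommutator, ← ht]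
  have hzero := eq_zero_of_monic_mul_mem_degreeLT hcomm hfree hmonic ⟨_, hmul⟩
  rw [hzero, mul_zero] at hmul
  rcases hi.lt_or_eq with hi | rfl
  · exact coeff_eq_zero_of_sum_eq_zero hfree hmul.symm hi
  · rw [ham, hD1]

end SkewPolynomial

/-- The Leibniz rule for powers in a noncommutative ring. -/
theorem leibniz_pow_succ {A : Type*} [Ring A] {δ : A → A}
    (hδmul : ∀ z w : A, δ (z * w) = δ z * w + z * δ w) (x : A) (k : ℕ) :
    δ (x ^ (k + 1)) = ∑ j ∈ Finset.range (k + 1), x ^ (k - j) * δ x * x ^ j := by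
  induction k with
  | zero => simp
  | succ k ih =>
    rw [pow_succ', hδmul, ih, Finset.sum_range_succ _ (k + 1), Finset.mul_sum, add_comm]
    congr 1
    · refine Finset.sum_congr rfl fun j hj => ?_
      rw [Nat.succ_sub (Nat.lt_succ_iff.1 (Finset.mem_range.1 hj)), pow_succ']
      simp only [mul_assoc]
    · simp

/-- In the setting of a monic `f = Σ_{i=0}^{m} X^i a_i` of degree `m ≥ 1` in `R = B[X;ρ,D]`
with all `a_i ∈ B^ρ` and `fR = Rf`, with `A = R/fR`, `x = X + fR`,
`y_j = Σ_{k=j}^{m−1} x^{k−j} a_{k+1}` and `τ(z) = Σ_{j=0}^{m−1} y_j z x^j`: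
if `δ` is a `B`-derivation of `A`, then `δ(x) ∈ A_1` and `τ(δ(x)) = 0`;
that is, `δ(x) ∈ A_1 ∩ Ker(τ)`. -/
theorem stmt10 {B R A : Type*} [Ring B] [Ring R] [Ring A]
    (ι : B →+* R) (hι : Function.Injective ι) (X : R)
    (ρ : B ≃+* B) (D : B →+ B)
    (hD : ∀ α β : B, D (α * β) = D α * ρ β + α * D β)
    (hcomm : ∀ α : B, ι α * X = X * ι (ρ α) + ι (D α))
    (hfree : ∀ r : R, ∃! c : ℕ →₀ B, r = c.sum fun i b => X ^ i * ι b)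
    (m : ℕ) (hm : 1 ≤ m) (a : ℕ → B) (ham : a m = 1)
    (hρa : ∀ i ≤ m, ρ (a i) = a i)
    (f : R) (hf : f = ∑ i ∈ Finset.range (m + 1), X ^ i * ι (a i))
    (htwo : (Set.range fun r => f * r) = Set.range fun r => r * f)
    (π : R →+* A) (hπ : Function.Surjective π)
    (hker : ∀ r : R, π r = 0 ↔ ∃ s, r = f * s)
    (y : ℕ → A)
    (hy : ∀ j, y j = ∑ k ∈ Finset.Icc j (m - 1), π X ^ (k - j) * π (ι (a (k + 1))))
    (τ : A → A)
    (hτ : ∀ z, τ z = ∑ j ∈ Finset.range m, y j * z * π X ^ j)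
    (δ : A → A)
    (hδadd : ∀ z w : A, δ (z + w) = δ z + δ w)
    (hδmul : ∀ z w : A, δ (z * w) = δ z * w + z * δ w)
    (hδB : ∀ β : B, δ (π (ι β)) = 0) :
    (∀ α : B, π (ι α) * δ (π X) = δ (π X) * π (ι (ρ α))) ∧ τ (δ (π X)) = 0 := by
  have hA1 : ∀ α : B, π (ι α) * δ (π X) = δ (π X) * π (ι (ρ α)) := by
    intro α
    have h := congrArg δ (congrArg π (hcomm α))
    simpa [hδmul, hδadd, hδB] using h
  refine ⟨hA1, ?_⟩
  have hDa (i : ℕ) (hi : i ≤ m) : D (a i) = 0 :=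
    SkewPolynomial.derivation_coeff_eq_zero hD hcomm hfree ham hρa hf htwo hi
  have hcomm_pow (i : ℕ) (hi : i ≤ m) (j : ℕ) : Commute (π (ι (a i))) (δ (π X) * π X ^ j) := by
    refine Commute.mul_right ?_ (Commute.pow_right ?_ j)
    · rw [commute_iff_eq, hA1, hρa i hi]
    · rw [commute_iff_eq, ← map_mul, hcomm, hρa i hi, hDa i hi, map_zero, add_zero, map_mul]
  have hδ1 : δ 1 = 0 := by simpa using hδB 1
  let δ' : A →+ A := AddMonoidHom.mk' δ hδadd
  have hfx : ∑ k ∈ Finset.range m, δ (π X ^ (k + 1)) * π (ι (a (k + 1))) = 0 := by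
    have h0 : π f = 0 := (hker f).2 ⟨1, by simp⟩
    have h := congrArg δ' h0
    rw [hf, map_sum, map_sum, Finset.sum_range_succ', map_zero] at h
    simpa [δ', hδmul, hδB, hδ1] using h
  rw [hτ, ← hfx]
  simp only [hy, Finset.sum_mul, leibniz_pow_succ hδmul]
  rw [Finset.sum_comm' (t' := Finset.range m) (s' := fun k => Finset.range (k + 1))
    (by intro j k; simp only [Finset.mem_range, Finset.mem_Icc]; omega)]
  refine Finset.sum_congr rfl fun k hk => Finset.sum_congr rfl fun j _ => ?_
  have h := hcomm_pow (k + 1) (Finset.mem_range.1 hk) j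
  rw [mul_assoc, mul_assoc, h.eq]
  simp only [mul_assoc]
end
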